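/- Let X be a set and 𝓟 a family of subsets of X such that: (1) 𝓟 is well-founded under inclusion; (2) X is a finite union of elements of 𝓟; (3) for all P, Q ∈ 𝓟, the intersection P ∩ Q is a finite union of elements of 𝓟. Then X, equipped with the coarsest topology making every element of 𝓟 closed, is a Noetherian space. -/

import Mathlib

universe u

/-- The coarsest topology on `X` making every element of `𝓟` closed. -/
def cotopOfClosed {X : Type u} (𝓟 : Set (Set X)) : TopologicalSpace X :=
  TopologicalSpace.generateFrom {U : Set X | ∃ P ∈ 𝓟, U = Pᶜ}

/-- Finite subcovers of finitely many pieces combine. -/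
theorem finite_subcover_sUnion {X : Type u} (s : Set X) (S 𝓕 : Set (Set X)) (hF : 𝓕.Finite)
    (h : ∀ P ∈ 𝓕, ∃ Q ⊆ S, Q.Finite ∧ P ∩ s ⊆ ⋃₀ Q) :
    ∃ Q ⊆ S, Q.Finite ∧ ⋃₀ 𝓕 ∩ s ⊆ ⋃₀ Q := by
  choose! f hf using h
  refine ⟨⋃ P ∈ 𝓕, f P, Set.iUnion₂_subset fun P hP => (hf P hP).1,
    hF.biUnion fun P hP => (hf P hP).2.1, ?_⟩
  rintro x ⟨⟨P, hP, hxP⟩, hxs⟩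
  obtain ⟨U, hU, hxU⟩ := (hf P hP).2.2 ⟨hxP, hxs⟩
  exact ⟨U, Set.mem_biUnion hP hU, hxU⟩

theorem noetherian_of_family {X : Type u} (𝓟 : Set (Set X))
    (hwf : 𝓟.WellFoundedOn (· ⊂ ·))
    (hcover : ∃ 𝓕 ⊆ 𝓟, 𝓕.Finite ∧ ⋃₀ 𝓕 = Set.univ)
    (hinter : ∀ P ∈ 𝓟, ∀ Q ∈ 𝓟, ∃ 𝓕 ⊆ 𝓟, 𝓕.Finite ∧ P ∩ Q = ⋃₀ 𝓕) :
    @TopologicalSpace.NoetherianSpace X (cotopOfClosed 𝓟) := by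
  letI := cotopOfClosed 𝓟
  rw [TopologicalSpace.noetherianSpace_iff_isCompact]
  intro s
  refine isCompact_generateFrom (S := {U : Set X | ∃ P ∈ 𝓟, U = Pᶜ}) rfl fun S hS hs => ?_
  have key : ∀ P ∈ 𝓟, ∃ Q ⊆ S, Q.Finite ∧ P ∩ s ⊆ ⋃₀ Q := by
    intro P hP
    refine hwf.induction (P := fun P => ∃ Q ⊆ S, Q.Finite ∧ P ∩ s ⊆ ⋃₀ Q) hP ?_
    clear hP P
    intro P hP ih
    by_cases h : ∀ Q ∈ 𝓟, Qᶜ ∈ S → P ⊆ Q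
    · refine ⟨∅, Set.empty_subset _, Set.finite_empty, ?_⟩
      rintro x ⟨hxP, hxs⟩
      obtain ⟨U, hU, hxU⟩ := hs hxs
      obtain ⟨Q, hQ, rfl⟩ := hS hU
      exact absurd (h Q hQ hU hxP) hxU
    · push Not at h
      obtain ⟨Q, hQ, hQS, hPQ⟩ := h
      obtain ⟨𝓕, hF, hfin, heq⟩ := hinter P hP Q hQ
      obtain ⟨R, hRS, hRfin, hR⟩ := finite_subcover_sUnion s S 𝓕 hfin (fun A hA => by
        have hA' : A ⊆ P ∩ Q := heq ▸ Set.subset_sUnion_of_mem hA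
        exact ih A (hF hA) ⟨hA'.trans Set.inter_subset_left,
          fun h => hPQ (h.trans (hA'.trans Set.inter_subset_right))⟩)
      refine ⟨insert Qᶜ R, Set.insert_subset hQS hRS, hRfin.insert _, ?_⟩
      rintro x ⟨hxP, hxs⟩
      by_cases hxQ : x ∈ Q
      · obtain ⟨U, hU, hxU⟩ := hR ⟨heq ▸ ⟨hxP, hxQ⟩, hxs⟩
        exact ⟨U, Or.inr hU, hxU⟩
      · exact ⟨Qᶜ, Or.inl rfl, hxQ⟩
  obtain ⟨𝓕, hF, hfin, heq⟩ := hcover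
  obtain ⟨R, hRS, hRfin, hR⟩ := finite_subcover_sUnion s S 𝓕 hfin fun A hA => key A (hF hA)
  rw [heq, Set.univ_inter] at hR
  exact ⟨R, hRS, hRfin, hR⟩
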